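/- Let (V_n)_{n≥1} be nonnegative random variables and Ḡ : [0,∞) → [0,∞) nonincreasing with sup_n P(V_n > t) ≤ Ḡ(t) for all t ≥ 0 and ∫_0^∞ Ḡ(t) dt = C_G < ∞. Set Ṽ_n := min(V_n, n). Then for every real p > 1, ∑_{n=3}^∞ E[Ṽ_n^p]/n^p ≤ C_G (2p-1)/(p-1). -/

import Mathlib

open MeasureTheory ProbabilityTheory Filter Topology Real

lemma riemann_sum_aux (H : ℝ → ℝ) (hH : Antitone H) (s : ℝ) (hs : 0 < s) :
    ∑' n : {n : ℕ // 3 ≤ n}, ENNReal.ofReal (H (n.1 * s)) * ENNReal.ofReal s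
      ≤ ∫⁻ t in Set.Ioi (0:ℝ), ENNReal.ofReal (H t) := by
  let A : {n : ℕ // 3 ≤ n} → Set ℝ := fun n => Set.Ioc (((n.1:ℝ) - 1) * s) (n.1 * s)
  have hA : ∀ n, MeasurableSet (A n) := fun n => measurableSet_Ioc
  have hlt : ∀ m n : {n : ℕ // 3 ≤ n}, m.1 < n.1 → Disjoint (A m) (A n) := by
    intro m n h
    rw [Set.disjoint_left]
    rintro x ⟨_, hx⟩ ⟨hx', _⟩
    have h1 : (m.1:ℝ) + 1 ≤ n.1 := by exact_mod_cast h
    nlinarith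
  have hd : Pairwise (Function.onFun Disjoint A) := by
    intro m n hmn
    have : m.1 ≠ n.1 := fun h => hmn (Subtype.ext h)
    rcases lt_or_gt_of_ne this with h | h
    · exact hlt m n h
    · exact (hlt n m h).symm
  calc _ ≤ ∑' n, ∫⁻ t in A n, ENNReal.ofReal (H t) := by
        refine ENNReal.tsum_le_tsum fun n => ?_
        have hv : volume (A n) = ENNReal.ofReal s := by
          simp only [A, Real.volume_Ioc]; congr 1; ring
        rw [← hv, ← setLIntegral_const]
        exact setLIntegral_mono' (hA n) fun t ht => ENNReal.ofReal_le_ofReal (hH ht.2)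
    _ = ∫⁻ t in ⋃ n, A n, ENNReal.ofReal (H t) := (lintegral_iUnion hA hd _).symm
    _ ≤ _ := by
        refine lintegral_mono_set (Set.iUnion_subset fun n t ht => ?_)
        have h1 : (3:ℝ) ≤ n.1 := by exact_mod_cast n.2
        have := ht.1
        simp only [Set.mem_Ioi]
        nlinarith

lemma moment_aux {Ω : Type*} [MeasureSpace Ω]
    (V : Ω → ℝ) (hVm : Measurable V) (hV0 : ∀ ω, 0 ≤ V ω)
    (H : ℝ → ℝ) (hdom : ∀ t, 0 ≤ t → ℙ {ω | t < V ω} ≤ ENNReal.ofReal (H t))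
    (p : ℝ) (hp : 1 < p) (n : ℕ) (hn : 3 ≤ n) :
    ENNReal.ofReal ((∫ ω, (min (V ω) (n : ℝ)) ^ p ∂ℙ) / (n : ℝ) ^ p) ≤
      ENNReal.ofReal p * ∫⁻ s in Set.Ioo (0:ℝ) 1,
        ENNReal.ofReal (H (n * s)) * ENNReal.ofReal (s ^ (p - 1)) := by
  have hn0 : (0:ℝ) < n := by exact_mod_cast (by omega : 0 < n)
  let W : Ω → ℝ := fun ω => min (V ω) n / n
  have hW0 : ∀ ω, 0 ≤ W ω := fun ω => div_nonneg (le_min (hV0 ω) hn0.le) hn0.le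
  have hWm : Measurable W := (hVm.min measurable_const).div_const _
  have h1 : (∫ ω, (min (V ω) (n : ℝ)) ^ p ∂ℙ) / (n : ℝ) ^ p = ∫ ω, W ω ^ p ∂ℙ := by
    rw [← integral_div]
    congr 1; ext ω
    rw [Real.div_rpow (le_min (hV0 ω) hn0.le) hn0.le]
  rw [h1, integral_eq_lintegral_of_nonneg_ae
    (Eventually.of_forall fun ω => Real.rpow_nonneg (hW0 ω) _)
    (hWm.pow_const p).aestronglyMeasurable]
  refine ENNReal.ofReal_toReal_le.trans ?_
  rw [lintegral_rpow_eq_lintegral_meas_lt_mul ℙ (Eventually.of_forall hW0) hWm.aemeasurable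
    (by linarith : 0 < p)]
  gcongr ENNReal.ofReal p * ?_
  rw [← lintegral_indicator measurableSet_Ioi, ← lintegral_indicator measurableSet_Ioo]
  refine lintegral_mono fun s => ?_
  by_cases hs0 : 0 < s
  · rw [Set.indicator_of_mem (show s ∈ Set.Ioi (0:ℝ) from hs0)]
    by_cases hs1 : s < 1
    · rw [Set.indicator_of_mem (show s ∈ Set.Ioo (0:ℝ) 1 from ⟨hs0, hs1⟩)]
      gcongr
      refine le_trans (measure_mono ?_) (hdom (n * s) (by positivity))
      intro ω hω
      have : s < min (V ω) n / n := hω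
      rw [lt_div_iff₀ hn0] at this
      have := this.trans_le (min_le_left _ _)
      simp only [Set.mem_ofPred_eq]
      linarith
    · have : {ω | s < W ω} = ∅ := by
        ext ω
        simp only [Set.mem_ofPred_eq, Set.mem_empty_iff_false, iff_false, not_lt]
        refine le_trans ?_ (not_lt.1 hs1)
        exact (div_le_one hn0).2 (min_le_right _ _)
      rw [this]; simp
  · rw [Set.indicator_of_notMem (show s ∉ Set.Ioi (0:ℝ) from hs0)]
    exact zero_le

lemma power_aux (p : ℝ) (hp : 1 < p) :
    ∫⁻ s in Set.Ioo (0:ℝ) 1, ENNReal.ofReal (s ^ (p - 2)) = ENNReal.ofReal (1 / (p - 1)) := by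
  have hi : IntegrableOn (fun s : ℝ => s ^ (p - 2)) (Set.Ioc 0 1) :=
    (intervalIntegrable_iff_integrableOn_Ioc_of_le zero_le_one).1
      (intervalIntegral.intervalIntegrable_rpow' (by linarith))
  rw [setLIntegral_congr Ioo_ae_eq_Ioc, ← ofReal_integral_eq_lintegral_ofReal hi]
  · rw [← intervalIntegral.integral_of_le zero_le_one, integral_rpow (Or.inl (by linarith))]
    rw [Real.zero_rpow (by linarith), Real.one_rpow]
    congr 1; ring_nf
  · exact (ae_restrict_iff' measurableSet_Ioc).2
      (Eventually.of_forall fun s hs => Real.rpow_nonneg hs.1.le _)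

theorem truncated_moment_series_bound {Ω : Type*} [MeasureSpace Ω]
    [IsProbabilityMeasure (ℙ : Measure Ω)]
    (V : ℕ → Ω → ℝ) (hVm : ∀ n, Measurable (V n)) (hV0 : ∀ n ω, 0 ≤ V n ω)
    (G : ℝ → ℝ) (hG0 : ∀ t, 0 ≤ t → 0 ≤ G t) (hGanti : AntitoneOn G (Set.Ici 0))
    (hdom : ∀ n t, 0 ≤ t → ℙ {ω | t < V n ω} ≤ ENNReal.ofReal (G t))
    (hGint : IntegrableOn G (Set.Ioi 0))
    (C_G : ℝ) (hC : C_G = ∫ t in Set.Ioi (0:ℝ), G t)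
    (p : ℝ) (hp : 1 < p) :
    ∑' n : {n : ℕ // 3 ≤ n},
        (∫ ω, (min (V n.1 ω) (n.1 : ℝ)) ^ p ∂ℙ) / (n.1 : ℝ) ^ p
      ≤ C_G * (2 * p - 1) / (p - 1) := by
  have hp1 : 0 < p - 1 := by linarith
  let H : ℝ → ℝ := fun t => G (max t 0)
  have hHG : ∀ t, 0 ≤ t → H t = G t := fun t ht => by simp only [H, max_eq_left ht]
  have hH : Antitone H := fun a b hab =>
    hGanti (Set.mem_Ici.2 (le_max_right _ _)) (Set.mem_Ici.2 (le_max_right _ _)) (max_le_max_right 0 hab)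
  have hC0 : 0 ≤ C_G := by
    rw [hC]; exact setIntegral_nonneg measurableSet_Ioi fun t ht => hG0 t (le_of_lt ht)
  have hCl : ∫⁻ t in Set.Ioi (0:ℝ), ENNReal.ofReal (H t) = ENNReal.ofReal C_G := by
    rw [hC, ofReal_integral_eq_lintegral_ofReal hGint]
    · exact setLIntegral_congr_fun measurableSet_Ioi fun t ht => by
        simp only [hHG t (le_of_lt ht)]
    · exact (ae_restrict_iff' measurableSet_Ioi).2
        (Eventually.of_forall fun t ht => hG0 t (le_of_lt ht))
  have key : ∑' n : {n : ℕ // 3 ≤ n},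
      ENNReal.ofReal ((∫ ω, (min (V n.1 ω) (n.1 : ℝ)) ^ p ∂ℙ) / (n.1 : ℝ) ^ p)
      ≤ ENNReal.ofReal (p * (C_G * (1 / (p - 1)))) := by
    calc _ ≤ ∑' n : {n : ℕ // 3 ≤ n}, ENNReal.ofReal p * ∫⁻ s in Set.Ioo (0:ℝ) 1,
          ENNReal.ofReal (H (n.1 * s)) * ENNReal.ofReal (s ^ (p - 1)) := by
          refine ENNReal.tsum_le_tsum fun n => ?_
          exact moment_aux (V n.1) (hVm _) (hV0 _) H
            (fun t ht => by rw [hHG t ht]; exact hdom _ t ht) p hp n.1 n.2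
      _ = ENNReal.ofReal p * ∫⁻ s in Set.Ioo (0:ℝ) 1, ∑' n : {n : ℕ // 3 ≤ n},
          ENNReal.ofReal (H (n.1 * s)) * ENNReal.ofReal (s ^ (p - 1)) := by
          rw [ENNReal.tsum_mul_left, lintegral_tsum]
          intro n
          have := hH.measurable
          refine Measurable.aemeasurable ?_
          fun_prop
      _ ≤ ENNReal.ofReal p * ∫⁻ s in Set.Ioo (0:ℝ) 1,
          ENNReal.ofReal C_G * ENNReal.ofReal (s ^ (p - 2)) := by
          gcongr ENNReal.ofReal p * ?_
          refine setLIntegral_mono' measurableSet_Ioo fun s hs => ?_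
          have hs0 : 0 < s := hs.1
          have e : s ^ (p - 1) = s * s ^ (p - 2) := by
            rw [show p - 1 = 1 + (p - 2) by ring, Real.rpow_add hs0, Real.rpow_one]
          rw [e, ENNReal.ofReal_mul hs0.le]
          simp_rw [← mul_assoc]
          rw [ENNReal.tsum_mul_right, ← hCl]
          gcongr
          exact riemann_sum_aux H hH s hs0
      _ = _ := by
          rw [lintegral_const_mul' _ _ ENNReal.ofReal_ne_top, power_aux p hp,
            ← ENNReal.ofReal_mul hC0, ← ENNReal.ofReal_mul (by linarith)]
  have hnn : ∀ n : {n : ℕ // 3 ≤ n},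
      0 ≤ (∫ ω, (min (V n.1 ω) (n.1 : ℝ)) ^ p ∂ℙ) / (n.1 : ℝ) ^ p := fun n =>
    div_nonneg (integral_nonneg fun ω => Real.rpow_nonneg (le_min (hV0 _ ω) (Nat.cast_nonneg _)) _)
      (Real.rpow_nonneg (Nat.cast_nonneg _) _)
  have hB : 0 ≤ p * (C_G * (1 / (p - 1))) := by positivity
  calc _ ≤ p * (C_G * (1 / (p - 1))) := by
        refine Real.tsum_le_of_sum_le hnn fun u => ?_
        rw [← ENNReal.ofReal_le_ofReal_iff hB, ENNReal.ofReal_sum_of_nonneg fun n _ => hnn n]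
        exact (ENNReal.sum_le_tsum u).trans key
    _ ≤ _ := by
        rw [mul_one_div, mul_div_assoc', div_le_div_iff_of_pos_right hp1]
        nlinarith
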